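/- In ℝ² let L₁ = {x : x₁ = −1}, L₂ = {x : x₁ = 1}, L₃ = {x : x₂ = 1}, and L₄ = {x : x₁x₂ = 0, x₁ ≥ 0, x₂ ≥ 0}. Then {L₁, L₂, L₃, L₄} is an affine arrangement of topolines in ℝ² that is not projectivizable (indeed L₁ ∩ L₂ = ∅ and L₁ ∩ L₄ = ∅ but L₂ ∩ L₄ ≠ ∅, so parallelism is not transitive). -/

import Mathlib

open Set

/-- The `i`-th coordinate hyperplane in `ℝⁿ` (by convention the whole space if `i ≥ n`). -/
def coordHyp (n i : ℕ) : Set (Fin n → ℝ) := {x | ∀ h : i < n, x ⟨i, h⟩ = 0}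

/-- `H` is a topological hyperplane (topoplane) in `ℝⁿ`: some self-homeomorphism of `ℝⁿ`
carries `H` onto the coordinate hyperplane `{x | x₁ = 0}`. -/
def IsTopoplane {n : ℕ} (H : Set (Fin n → ℝ)) : Prop :=
  ∃ e : (Fin n → ℝ) ≃ₜ (Fin n → ℝ), e '' H = coordHyp n 0

/-- `Z` is a relative topoplane in `Y ⊆ ℝⁿ`: `Z ⊆ Y` and some homeomorphism of `Y`
(with the subspace topology) onto some `ℝᵈ`, `d ≥ 1`, carries `Z` onto `{x | x₁ = 0}`. -/
def IsRelTopoplane {n : ℕ} (Y Z : Set (Fin n → ℝ)) : Prop :=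
  Z ⊆ Y ∧ ∃ d : ℕ, 1 ≤ d ∧ ∃ φ : Y ≃ₜ (Fin d → ℝ),
    φ '' {y : Y | (y : Fin n → ℝ) ∈ Z} = coordHyp d 0

/-- `Y` is a flat of the family `𝓗`: a nonempty intersection of a subfamily of `𝓗`
(the empty intersection being all of `ℝⁿ`). -/
def IsFlat {n : ℕ} (𝓗 : Set (Set (Fin n → ℝ))) (Y : Set (Fin n → ℝ)) : Prop :=
  (∃ 𝓢 ⊆ 𝓗, Y = ⋂₀ 𝓢) ∧ Y.Nonempty

/-- `𝓗` is an arrangement of topoplanes in `ℝⁿ`: a finite set of topoplanes such that for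
every `H ∈ 𝓗` and every flat `Y`, either `Y ⊆ H`, or `H ∩ Y = ∅`, or `H ∩ Y` is a
relative topoplane in `Y`. -/
def IsArrangement {n : ℕ} (𝓗 : Set (Set (Fin n → ℝ))) : Prop :=
  𝓗.Finite ∧ (∀ H ∈ 𝓗, IsTopoplane H) ∧
    ∀ H ∈ 𝓗, ∀ Y : Set (Fin n → ℝ), IsFlat 𝓗 Y →
      Y ⊆ H ∨ H ∩ Y = ∅ ∨ IsRelTopoplane Y (H ∩ Y)

/-- `Y` has dimension `d`: it is homeomorphic, in the subspace topology, to `ℝᵈ`. -/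
def HasDim {n : ℕ} (Y : Set (Fin n → ℝ)) (d : ℕ) : Prop :=
  Nonempty (Y ≃ₜ (Fin d → ℝ))

/-- Topoplanes `H₁`, `H₂` cross: some self-homeomorphism of `ℝⁿ` carries them
simultaneously onto the coordinate hyperplanes `{x | x₁ = 0}` and `{x | x₂ = 0}`. -/
def Crosses {n : ℕ} (H₁ H₂ : Set (Fin n → ℝ)) : Prop :=
  ∃ e : (Fin n → ℝ) ≃ₜ (Fin n → ℝ), e '' H₁ = coordHyp n 0 ∧ e '' H₂ = coordHyp n 1

/-- The pairwise condition for an arrangement to be affine: any two distinct members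
are disjoint or cross. -/
def PairwiseAffine {n : ℕ} (𝓗 : Set (Set (Fin n → ℝ))) : Prop :=
  ∀ H₁ ∈ 𝓗, ∀ H₂ ∈ 𝓗, H₁ ≠ H₂ → H₁ ∩ H₂ = ∅ ∨ Crosses H₁ H₂

/-- The unit `n`-sphere `Sⁿ ⊆ ℝ^{n+1}`, as a topological space. -/
abbrev Sph (n : ℕ) : Type :=
  ↥(Metric.sphere (0 : EuclideanSpace ℝ (Fin (n + 1))) 1)

/-- The equator `Sⁿ ∩ {x : x₁ = 0}` of `Sⁿ` (homeomorphic to `S^{n-1}`). -/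
def sphEquator (n : ℕ) : Set (Sph n) :=
  {x | (x : EuclideanSpace ℝ (Fin (n + 1))) 0 = 0}

/-- `𝓢` is an arrangement of pseudospheres in `Sⁿ`: a finite set of centrally symmetric
pseudospheres such that every subfamily intersection is homeomorphic to a sphere of some
dimension (possibly the empty sphere), and for every subfamily `𝓢'` and `S ∈ 𝓢` with
`⋂𝓢' ⊄ S`, some homeomorphism from `⋂𝓢'` onto a standard sphere `S^d` carries `S ∩ ⋂𝓢'`
onto an equator `S^{d-1}`. -/
def IsPseudosphereArr {n : ℕ} (𝓢 : Set (Set (Sph n))) : Prop :=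
  𝓢.Finite ∧
  (∀ S ∈ 𝓢,
    (∀ x ∈ S, ∀ y : Sph n,
      (y : EuclideanSpace ℝ (Fin (n + 1))) = -(x : EuclideanSpace ℝ (Fin (n + 1))) →
        y ∈ S) ∧
    ∃ e : Sph n ≃ₜ Sph n, e '' S = sphEquator n) ∧
  (∀ 𝓢' ⊆ 𝓢, ⋂₀ 𝓢' = (∅ : Set (Sph n)) ∨
    ∃ d : ℕ, Nonempty (↥(⋂₀ 𝓢') ≃ₜ Sph d)) ∧
  (∀ 𝓢' ⊆ 𝓢, ∀ S ∈ 𝓢, ¬⋂₀ 𝓢' ⊆ S →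
    ∃ d : ℕ, ∃ ψ : ↥(⋂₀ 𝓢') ≃ₜ Sph d,
      ψ '' {y : ↥(⋂₀ 𝓢') | (y : Sph n) ∈ S} = sphEquator d)

/-- `𝓐` is projectivizable: there are an arrangement of pseudospheres `𝓢` in `Sⁿ`, a
member `S₀ ∈ 𝓢`, a connected component `D` of `Sⁿ ∖ S₀` and a homeomorphism `f` from `ℝⁿ`
onto `D` with `{f(A) : A ∈ 𝓐} = {S ∩ D : S ∈ 𝓢, S ≠ S₀}`. -/
def Projectivizable {n : ℕ} (𝓐 : Set (Set (Fin n → ℝ))) : Prop :=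
  ∃ 𝓢 : Set (Set (Sph n)), IsPseudosphereArr 𝓢 ∧
    ∃ S₀ ∈ 𝓢, ∃ D : Set (Sph n),
      (∃ x ∈ S₀ᶜ, D = connectedComponentIn S₀ᶜ x) ∧
      ∃ f : (Fin n → ℝ) ≃ₜ ↥D,
        {B : Set (Sph n) | ∃ A ∈ 𝓐, B = Subtype.val '' (⇑f '' A)} =
          {B : Set (Sph n) | ∃ S ∈ 𝓢, S ≠ S₀ ∧ B = S ∩ D}

theorem mem_coordHyp_two_zero (x : Fin 2 → ℝ) : x ∈ coordHyp 2 0 ↔ x 0 = 0 := by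
  simp [coordHyp]

theorem mem_coordHyp_two_one (x : Fin 2 → ℝ) : x ∈ coordHyp 2 1 ↔ x 1 = 0 := by
  simp [coordHyp]

theorem Homeomorph.image_eq_of_forall_mem_iff {X Y : Type*} [TopologicalSpace X]
    [TopologicalSpace Y] (e : X ≃ₜ Y) {A : Set X} {B : Set Y} (h : ∀ x, x ∈ A ↔ e x ∈ B) :
    e '' A = B := by
  ext y
  rw [← e.apply_symm_apply y, e.injective.mem_set_image, h]

/-! ### Crossing topolines in the plane -/

/-- Exchange of the two coordinates of the plane. -/
def swapPlane : (Fin 2 → ℝ) ≃ₜ (Fin 2 → ℝ) where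
  toFun x := ![x 1, x 0]
  invFun x := ![x 1, x 0]
  left_inv x := by ext i; fin_cases i <;> simp
  right_inv x := by ext i; fin_cases i <;> simp
  continuous_toFun := by fun_prop
  continuous_invFun := by fun_prop

theorem crosses_of_forall_iff {A B : Set (Fin 2 → ℝ)} (e : (Fin 2 → ℝ) ≃ₜ (Fin 2 → ℝ))
    (hA : ∀ x, x ∈ A ↔ e x 0 = 0) (hB : ∀ x, x ∈ B ↔ e x 1 = 0) : Crosses A B :=
  ⟨e, e.image_eq_of_forall_mem_iff fun x => by rw [hA, mem_coordHyp_two_zero],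
    e.image_eq_of_forall_mem_iff fun x => by rw [hB, mem_coordHyp_two_one]⟩

theorem Crosses.exists_forall_iff {A B : Set (Fin 2 → ℝ)} (h : Crosses A B) :
    ∃ e : (Fin 2 → ℝ) ≃ₜ (Fin 2 → ℝ), (∀ x, x ∈ A ↔ e x 0 = 0) ∧ ∀ x, x ∈ B ↔ e x 1 = 0 := by
  obtain ⟨e, hA, hB⟩ := h
  refine ⟨e, fun x => ?_, fun x => ?_⟩
  · rw [← mem_coordHyp_two_zero, ← hA, e.injective.mem_set_image]
  · rw [← mem_coordHyp_two_one, ← hB, e.injective.mem_set_image]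

theorem Crosses.symm {A B : Set (Fin 2 → ℝ)} (h : Crosses A B) : Crosses B A := by
  obtain ⟨e, hA, hB⟩ := h.exists_forall_iff
  exact crosses_of_forall_iff (e.trans swapPlane)
    (fun x => by simp [swapPlane, hB]) (fun x => by simp [swapPlane, hA])

theorem Crosses.isTopoplane {n : ℕ} {A B : Set (Fin n → ℝ)} (h : Crosses A B) :
    IsTopoplane A :=
  let ⟨e, he, _⟩ := h
  ⟨e, he⟩

theorem Crosses.subsingleton_inter {A B : Set (Fin 2 → ℝ)} (h : Crosses A B) :
    (A ∩ B).Subsingleton := by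
  obtain ⟨e, hA, hB⟩ := h.exists_forall_iff
  rintro x ⟨hxA, hxB⟩ y ⟨hyA, hyB⟩
  apply e.injective
  ext i
  fin_cases i
  · exact ((hA x).1 hxA).trans ((hA y).1 hyA).symm
  · exact ((hB x).1 hxB).trans ((hB y).1 hyB).symm

theorem Crosses.isRelTopoplane_inter {A B : Set (Fin 2 → ℝ)} (h : Crosses A B) :
    IsRelTopoplane A (B ∩ A) := by
  obtain ⟨e, hA, hB⟩ := h.exists_forall_iff
  let φ : A ≃ₜ (Fin 1 → ℝ) :=
    { toFun := fun y _ => e y 1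
      invFun := fun t => ⟨e.symm ![0, t 0], by simp [hA]⟩
      left_inv := fun y => by
        ext1
        apply e.injective
        ext i
        fin_cases i
        · simpa using ((hA y).1 y.2).symm
        · simp
      right_inv := fun t => by
        ext i
        fin_cases i
        simp
      continuous_toFun := by fun_prop
      continuous_invFun := by fun_prop }
  refine ⟨inter_subset_right, 1, le_rfl, φ, φ.image_eq_of_forall_mem_iff fun y => ?_⟩
  have : (φ y : Fin 1 → ℝ) 0 = e y 1 := rfl
  simp [coordHyp, this, hB]

/-- In the plane, pairwise disjointness or crossing already gives an arrangement. -/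
theorem PairwiseAffine.isArrangement {𝓗 : Set (Set (Fin 2 → ℝ))} (h : PairwiseAffine 𝓗)
    (hfin : 𝓗.Finite) (htop : ∀ H ∈ 𝓗, IsTopoplane H) : IsArrangement 𝓗 := by
  refine ⟨hfin, htop, ?_⟩
  rintro H hH _ ⟨⟨𝓢, h𝓢, rfl⟩, hne⟩
  rcases 𝓢.eq_empty_or_nonempty with rfl | ⟨A, hA⟩
  · right; right
    obtain ⟨e, he⟩ := htop H hH
    refine ⟨inter_subset_right, 2, by norm_num,
      (Homeomorph.setCongr sInter_empty).trans ((Homeomorph.Set.univ _).trans e), ?_⟩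
    apply Homeomorph.image_eq_of_forall_mem_iff
    intro x
    rw [← he]
    simp only [mem_ofPred_eq, mem_inter_iff, x.2, and_true,
      Homeomorph.trans_apply, e.injective.mem_set_image]
    exact Iff.rfl
  by_cases hall : ∀ B ∈ 𝓢, B = A
  · have hY : ⋂₀ 𝓢 = A := by
      rw [show 𝓢 = {A} from Subset.antisymm hall (by simpa using hA), sInter_singleton]
    rw [hY]
    by_cases hAH : A = H
    · exact Or.inl hAH.subset
    · rcases h A (h𝓢 hA) H hH hAH with h0 | hc
      · exact Or.inr (Or.inl (by rwa [inter_comm]))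
      · exact Or.inr (Or.inr hc.isRelTopoplane_inter)
  · push Not at hall
    obtain ⟨B, hB, hBA⟩ := hall
    have hsub : ⋂₀ 𝓢 ⊆ B ∩ A := subset_inter (sInter_subset_of_mem hB) (sInter_subset_of_mem hA)
    rcases h B (h𝓢 hB) A (h𝓢 hA) hBA with h0 | hc
    · exact absurd (hne.mono hsub) (by simp [h0])
    · have hss := hc.subsingleton_inter.anti hsub
      obtain ⟨y, hy⟩ := hne
      by_cases hyH : y ∈ H
      · left
        intro z hz
        rwa [hss hz hy]
      · right; left
        ext z
        simp only [mem_inter_iff, mem_empty_iff_false, iff_false, not_and]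
        intro hzH hz
        exact hyH (hss hz hy ▸ hzH)

theorem crosses_vertical_horizontal (a b : ℝ) :
    Crosses {x : Fin 2 → ℝ | x 0 = a} {x | x 1 = b} :=
  crosses_of_forall_iff (Homeomorph.subRight ![a, b])
    (fun x => by simp [sub_eq_zero]) (fun x => by simp [sub_eq_zero])

/-- A self-homeomorphism of the plane straightening the boundary of the positive quadrant
together with the line `x₁ = 1`. -/
noncomputable def straighten : (Fin 2 → ℝ) ≃ₜ (Fin 2 → ℝ) where
  toFun x := ![min (x 0) (x 1) * (1 + max (x 1 - x 0) 0),
    min (x 0) (x 1) * (1 + max (x 1 - x 0) 0) + (x 0 - x 1) - 1]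
  invFun z := ![z 0 / (1 + max (z 0 - z 1 - 1) 0) + max (z 1 + 1 - z 0) 0,
    z 0 / (1 + max (z 0 - z 1 - 1) 0) + max (z 0 - z 1 - 1) 0]
  left_inv x := by
    have hpos : 0 < 1 + max (x 1 - x 0) 0 := by positivity
    have h1 : ∀ m : ℝ, m - (m + (x 0 - x 1) - 1) - 1 = x 1 - x 0 := fun m => by ring
    have h2 : ∀ m : ℝ, m + (x 0 - x 1) - 1 + 1 - m = x 0 - x 1 := fun m => by ring
    ext i
    fin_cases i
    · simp only [Fin.zero_eta, Matrix.cons_val_zero, Matrix.cons_val_one, h1, h2]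
      rw [mul_div_cancel_right₀ _ hpos.ne']
      rcases le_total (x 0) (x 1) with h | h
      · rw [min_eq_left h, max_eq_right (by linarith)]; ring
      · rw [min_eq_right h, max_eq_left (by linarith)]; ring
    · simp only [Fin.mk_one, Matrix.cons_val_zero, Matrix.cons_val_one, h1]
      rw [mul_div_cancel_right₀ _ hpos.ne']
      rcases le_total (x 0) (x 1) with h | h
      · rw [min_eq_left h, max_eq_left (by linarith)]; ring
      · rw [min_eq_right h, max_eq_right (by linarith)]; ring
  right_inv z := by
    have hpos : 0 < 1 + max (z 0 - z 1 - 1) 0 := by positivity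
    set u := z 0 / (1 + max (z 0 - z 1 - 1) 0) with hu
    have hmul : u * (1 + max (z 0 - z 1 - 1) 0) = z 0 := div_mul_cancel₀ _ hpos.ne'
    have hmin : min (u + max (z 1 + 1 - z 0) 0) (u + max (z 0 - z 1 - 1) 0) = u := by
      rcases le_total (z 1 + 1) (z 0) with h | h
      · rw [max_eq_right (by linarith), max_eq_left (by linarith), min_eq_left (by linarith)]
        ring
      · rw [max_eq_left (by linarith), max_eq_right (by linarith), min_eq_right (by linarith)]
        ring
    have hsub : (u + max (z 0 - z 1 - 1) 0) - (u + max (z 1 + 1 - z 0) 0) = z 0 - z 1 - 1 := by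
      rcases le_total (z 1 + 1) (z 0) with h | h
      · rw [max_eq_left (by linarith), max_eq_right (by linarith)]
        ring
      · rw [max_eq_right (by linarith), max_eq_left (by linarith)]
        ring
    ext i
    fin_cases i
    · simp only [Fin.zero_eta, Matrix.cons_val_zero, Matrix.cons_val_one, ← hu, hmin,
        hsub, hmul]
    · simp only [Fin.mk_one, Matrix.cons_val_zero, Matrix.cons_val_one, ← hu, hmin,
        hsub, hmul]
      linarith
  continuous_toFun := by fun_prop
  continuous_invFun := by
    have hpos : ∀ z : Fin 2 → ℝ, 1 + max (z 0 - z 1 - 1) 0 ≠ 0 := fun z => by positivity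
    fun_prop (disch := assumption)

theorem crosses_quadrantBoundary_vertical :
    Crosses {x : Fin 2 → ℝ | x 0 * x 1 = 0 ∧ 0 ≤ x 0 ∧ 0 ≤ x 1} {x | x 0 = 1} := by
  refine crosses_of_forall_iff straighten (fun x => ?_) (fun x => ?_)
  · have hpos : 1 + max (x 1 - x 0) 0 ≠ 0 := by positivity
    simp only [mem_ofPred_eq, straighten, Homeomorph.homeomorph_mk_coe, Equiv.coe_fn_mk,
      Matrix.cons_val_zero, mul_eq_zero, hpos, or_false]
    constructor
    · rintro ⟨h | h, h0, h1⟩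
      · rw [h, min_eq_left h1]
      · rw [h, min_eq_right h0]
    · intro h
      rcases min_choice (x 0) (x 1) with hm | hm
      · have h0 : x 0 = 0 := hm ▸ h
        exact ⟨Or.inl h0, h0.ge, h ▸ min_le_right _ _⟩
      · have h1 : x 1 = 0 := hm ▸ h
        exact ⟨Or.inr h1, h ▸ min_le_left _ _, h1.ge⟩
  · simp only [mem_ofPred_eq, straighten, Homeomorph.homeomorph_mk_coe, Equiv.coe_fn_mk,
      Matrix.cons_val_one, Matrix.cons_val_fin_one]
    rcases le_total (x 0) (x 1) with h | h
    · rw [min_eq_left h, max_eq_left (by linarith)]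
      constructor
      · intro h0
        rw [h0]
        ring
      · intro h0
        have : (x 0 - 1) * (1 + (x 1 - x 0)) = 0 := by linarith
        rcases mul_eq_zero.1 this with h1 | h1 <;> linarith
    · rw [min_eq_right h, max_eq_right (by linarith)]
      constructor <;> intro h0 <;> linarith

theorem crosses_quadrantBoundary_horizontal :
    Crosses {x : Fin 2 → ℝ | x 0 * x 1 = 0 ∧ 0 ≤ x 0 ∧ 0 ≤ x 1} {x | x 1 = 1} := by
  obtain ⟨e, hA, hB⟩ := crosses_quadrantBoundary_vertical.exists_forall_iff
  refine crosses_of_forall_iff (swapPlane.trans e) (fun x => ?_) (fun x => ?_)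
  · rw [Homeomorph.trans_apply, ← hA]
    simp [swapPlane, and_comm, or_comm]
  · rw [Homeomorph.trans_apply, ← hB]
    simp [swapPlane]

/-! ### Topology of spheres -/

theorem sph_ext {n : ℕ} {x y : Sph n}
    (h : ∀ i, (x : EuclideanSpace ℝ (Fin (n + 1))) i = (y : EuclideanSpace ℝ (Fin (n + 1))) i) :
    x = y := by
  ext i
  exact h i

theorem sph_sum_sq {n : ℕ} (x : Sph n) :
    ∑ i, (x : EuclideanSpace ℝ (Fin (n + 1))) i ^ 2 = 1 := by
  have h := x.2
  rw [mem_sphere_zero_iff_norm] at h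
  rw [← EuclideanSpace.real_norm_sq_eq, h, one_pow]

theorem sph_neg_ne_self {n : ℕ} (x : Sph n) : -x ≠ x := by
  intro h
  have := sph_sum_sq x
  have h0 : ∀ i, (x : EuclideanSpace ℝ (Fin (n + 1))) i = 0 := fun i => by
    have : (-(x : EuclideanSpace ℝ (Fin (n + 1)))) i = (x : EuclideanSpace ℝ (Fin (n + 1))) i :=
      congrArg (fun y : Sph n => (y : EuclideanSpace ℝ (Fin (n + 1))) i) h
    rw [PiLp.neg_apply] at this
    linarith
  simp [h0] at this

theorem isPreconnected_compl_pair_sph {d : ℕ} (hd : 2 ≤ d) {p q : Sph d} (hpq : p ≠ q) :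
    IsPreconnected ({p, q}ᶜ : Set (Sph d)) := by
  have : Fact (Module.finrank ℝ (EuclideanSpace ℝ (Fin (d + 1))) = d + 1) := ⟨by simp⟩
  let σ := stereographic' d p
  have hsrc : σ.source = {p}ᶜ := stereographic'_source p
  have htgt : σ.target = univ := stereographic'_target p
  have himg : ({p, q}ᶜ : Set (Sph d)) = σ.symm '' {σ q}ᶜ := by
    ext x
    constructor
    · intro hx
      simp only [mem_compl_iff, mem_insert_iff, mem_singleton_iff, not_or] at hx
      have hxs : x ∈ σ.source := by simpa [hsrc] using hx.1
      have hqs : q ∈ σ.source := by simpa [hsrc] using hpq.symm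
      exact ⟨σ x, fun h => hx.2 (σ.injOn hxs hqs h), σ.left_inv hxs⟩
    · rintro ⟨y, hy, rfl⟩
      have hyt : y ∈ σ.target := by simp [htgt]
      have h1 : σ.symm y ∈ σ.source := σ.map_target hyt
      simp only [mem_compl_iff, mem_insert_iff, mem_singleton_iff, not_or]
      refine ⟨by simpa [hsrc] using h1, fun h => hy ?_⟩
      rw [← h, σ.right_inv hyt]
      rfl
  rw [himg]
  refine IsPreconnected.image ?_ _ ?_
  · refine (isConnected_compl_singleton_of_one_lt_rank ?_ _).isPreconnected
    rw [← Module.finrank_eq_rank, finrank_euclideanSpace_fin]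
    exact_mod_cast hd
  · exact σ.continuousOn_symm.mono (by simp [htgt])

theorem isPreconnected_hemisphere (n : ℕ) :
    IsPreconnected {x : Sph n | 0 < (x : EuclideanSpace ℝ (Fin (n + 1))) 0} := by
  let C : Set (EuclideanSpace ℝ (Fin (n + 1))) := {y | 0 < y 0}
  have hne : ∀ y ∈ C, y ≠ 0 := by
    rintro y hy rfl
    simp [C] at hy
  have hC : IsPreconnected C := by
    apply Convex.isPreconnected
    intro x hx y hy a b ha hb hab
    simp only [C, mem_ofPred_eq, PiLp.add_apply, PiLp.smul_apply, smul_eq_mul] at hx hy ⊢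
    rcases ha.eq_or_lt with rfl | ha
    · simp_all
    · positivity
  rw [← Topology.IsInducing.subtypeVal.isPreconnected_image]
  have : ((↑) : Sph n → _) '' {x : Sph n | 0 < (x : EuclideanSpace ℝ (Fin (n + 1))) 0} =
      (fun y => ‖y‖⁻¹ • y) '' C := by
    ext y
    constructor
    · rintro ⟨x, hx, rfl⟩
      exact ⟨x, hx, by simp⟩
    · rintro ⟨y, hy, rfl⟩
      have hy' := norm_pos_iff.2 (hne y hy)
      refine ⟨⟨‖y‖⁻¹ • y, ?_⟩, ?_, rfl⟩
      · rw [mem_sphere_zero_iff_norm, norm_smul, norm_inv, norm_norm, inv_mul_cancel₀ hy'.ne']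
      · simp only [mem_ofPred_eq, PiLp.smul_apply, smul_eq_mul]
        exact mul_pos (inv_pos.2 hy') hy
  rw [this]
  refine hC.image _ (ContinuousOn.smul (ContinuousOn.inv₀ continuous_norm.continuousOn ?_)
    continuousOn_id)
  intro y hy
  exact norm_ne_zero_iff.2 (hne y hy)

theorem isPreconnected_hemisphere_neg (n : ℕ) :
    IsPreconnected {x : Sph n | (x : EuclideanSpace ℝ (Fin (n + 1))) 0 < 0} := by
  have h := (isPreconnected_hemisphere n).image (fun x => -x) continuous_neg.continuousOn
  convert h using 1
  ext x
  simp [Set.image_neg_eq_neg]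

/-- The point of `sphEquator 2` with given last two coordinates. -/
noncomputable def equatorPoint (a b : ℝ) (h : a ^ 2 + b ^ 2 = 1) : sphEquator 2 :=
  ⟨⟨!₂[0, a, b], by
    rw [mem_sphere_zero_iff_norm, EuclideanSpace.norm_eq]
    simp [Fin.sum_univ_three, h]⟩, by simp [sphEquator]⟩

theorem eq_one_of_homeomorph_sphEquator_two {d : ℕ} (φ : sphEquator 2 ≃ₜ Sph d) : d = 1 := by
  let P := equatorPoint 1 0 (by norm_num)
  let Q := equatorPoint (-1) 0 (by norm_num)
  let R := equatorPoint 0 1 (by norm_num)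
  let T := equatorPoint 0 (-1) (by norm_num)
  have coord : ∀ {x y : sphEquator 2}, x = y → ∀ i,
      (x : Sph 2).1 i = (y : Sph 2).1 i := fun h i => by rw [h]
  have hPQ : P ≠ Q := fun h => by
    have := coord h 1
    norm_num [P, Q, equatorPoint] at this
  have hPR : P ≠ R := fun h => by
    have := coord h 1
    norm_num [P, R, equatorPoint] at this
  have hQR : Q ≠ R := fun h => by
    have := coord h 1
    norm_num [Q, R, equatorPoint] at this
  have hPT : P ≠ T := fun h => by
    have := coord h 1
    norm_num [P, T, equatorPoint] at this
  have hQT : Q ≠ T := fun h => by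
    have := coord h 1
    norm_num [Q, T, equatorPoint] at this
  rcases Nat.lt_trichotomy d 1 with hd | hd | hd
  · exfalso
    obtain rfl : d = 0 := by omega
    have hv : ∀ x : Sph 0, x.1 0 = 1 ∨ x.1 0 = -1 := fun x => by
      have := sph_sum_sq x
      simpa using this
    have heq : ∀ x y : sphEquator 2, (φ x).1 0 = (φ y).1 0 → x = y := fun x y h => by
      apply φ.injective
      apply sph_ext
      intro i
      fin_cases i
      exact h
    rcases hv (φ P) with h1 | h1 <;> rcases hv (φ Q) with h2 | h2 <;>
      rcases hv (φ R) with h3 | h3 <;>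
      first
        | exact hPQ (heq _ _ (h1.trans h2.symm))
        | exact hPR (heq _ _ (h1.trans h3.symm))
        | exact hQR (heq _ _ (h2.trans h3.symm))
  · exact hd
  · exfalso
    have hpre : IsPreconnected ({P, Q}ᶜ : Set (sphEquator 2)) := by
      rw [← φ.isPreconnected_image, image_compl_eq φ.bijective, image_pair]
      exact isPreconnected_compl_pair_sph hd (φ.injective.ne hPQ)
    have hcont : Continuous fun x : sphEquator 2 => (x : Sph 2).1 2 := by fun_prop
    obtain ⟨x, hx, hx0⟩ := hpre.intermediate_value (a := T) (b := R)
      (by simp [hPT.symm, hQT.symm]) (by simp [hPR.symm, hQR.symm]) hcont.continuousOn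
      (show (0 : ℝ) ∈ Icc _ _ by simp [T, R, equatorPoint])
    have hsum := sph_sum_sq (x : Sph 2)
    have hx00 : (x : Sph 2).1 0 = 0 := x.2
    simp only at hx0
    rw [Fin.sum_univ_three, hx00, hx0] at hsum
    have h1 : (x : Sph 2).1 1 = 1 ∨ (x : Sph 2).1 1 = -1 := by simpa using hsum
    apply hx
    rcases h1 with h1 | h1
    · left
      apply Subtype.ext
      apply sph_ext
      intro i
      fin_cases i <;> simp [P, equatorPoint, hx00, hx0, h1]
    · right
      apply Subtype.ext
      apply sph_ext
      intro i
      fin_cases i <;> simp [Q, equatorPoint, hx00, hx0, h1]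

theorem exists_sphEquator_one_eq_pair : ∃ a b : Sph 1, sphEquator 1 = {a, b} := by
  refine ⟨⟨!₂[0, 1], by simp [EuclideanSpace.norm_eq]⟩,
    ⟨!₂[0, -1], by simp [EuclideanSpace.norm_eq]⟩, ?_⟩
  ext x
  simp only [sphEquator, mem_ofPred_eq, mem_insert_iff, mem_singleton_iff]
  constructor
  · intro h0
    have hsum := sph_sum_sq x
    rw [Fin.sum_univ_two, h0] at hsum
    have h1 : x.1 1 = 1 ∨ x.1 1 = -1 := by simpa using hsum
    refine h1.imp (fun h1 => ?_) (fun h1 => ?_) <;>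
    · apply sph_ext
      intro i
      fin_cases i <;> simp [h0, h1]
  · rintro (rfl | rfl) <;> simp

/-! ### Arrangements of pseudocircles -/

theorem IsPseudosphereArr.neg_mem {n : ℕ} {𝓢 : Set (Set (Sph n))} (h : IsPseudosphereArr 𝓢)
    {S : Set (Sph n)} (hS : S ∈ 𝓢) {x : Sph n} (hx : x ∈ S) : -x ∈ S :=
  (h.2.1 S hS).1 x hx (-x) rfl

theorem IsPseudosphereArr.exists_inter_eq_antipodal_pair {𝓢 : Set (Set (Sph 2))}
    (h : IsPseudosphereArr 𝓢) {S T : Set (Sph 2)} (hS : S ∈ 𝓢) (hT : T ∈ 𝓢) (hST : ¬S ⊆ T) :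
    ∃ p, S ∩ T = {p, -p} := by
  obtain ⟨d, ψ, hψ⟩ := h.2.2.2 {S} (by simpa using hS) T hT (by simpa using hST)
  obtain ⟨e, he⟩ := (h.2.1 S hS).2
  let χ : sphEquator 2 ≃ₜ Sph d :=
    (Homeomorph.setCongr he.symm).trans ((e.image S).symm.trans
      ((Homeomorph.setCongr (sInter_singleton S).symm).trans ψ))
  obtain rfl := eq_one_of_homeomorph_sphEquator_two χ
  obtain ⟨a, b, hab⟩ := exists_sphEquator_one_eq_pair
  have hinter : S ∩ T = {(ψ.symm a : Sph 2), (ψ.symm b : Sph 2)} := by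
    rw [hab] at hψ
    have h1 := congrArg (fun A => Subtype.val '' (ψ.symm '' A)) hψ
    simp only [image_pair, ← image_comp, ψ.symm_comp_self] at h1
    rw [← h1]
    ext x
    simp [and_comm]
  refine ⟨ψ.symm a, ?_⟩
  have ha : (ψ.symm a : Sph 2) ∈ S ∩ T := hinter ▸ mem_insert _ _
  have hna : -(ψ.symm a : Sph 2) ∈ S ∩ T := ⟨h.neg_mem hS ha.1, h.neg_mem hT ha.2⟩
  rw [hinter] at hna
  rcases hna with hna | hna
  · exact absurd hna (sph_neg_ne_self _)
  · rw [hinter, mem_singleton_iff.1 hna]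

/-- If the component `D` of the complement of a pseudosphere is not centrally symmetric, then
`D` and `-D` cover this complement. -/
theorem IsPseudosphereArr.mem_or_neg_mem_connectedComponentIn {n : ℕ} {𝓢 : Set (Set (Sph n))}
    (h : IsPseudosphereArr 𝓢) {S : Set (Sph n)} (hS : S ∈ 𝓢) {x : Sph n} (hx : x ∈ Sᶜ)
    (hsymm : ¬∀ z ∈ connectedComponentIn Sᶜ x, -z ∈ connectedComponentIn Sᶜ x)
    {y : Sph n} (hy : y ∈ Sᶜ) :
    y ∈ connectedComponentIn Sᶜ x ∨ -y ∈ connectedComponentIn Sᶜ x := by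
  obtain ⟨e, he⟩ := (h.2.1 S hS).2
  have hmemS : ∀ z, z ∈ S ↔ (e z).1 0 = 0 := fun z => by
    rw [← e.injective.mem_set_image, he]
    rfl
  have hnegS : ∀ z, z ∈ Sᶜ → -z ∈ Sᶜ := fun z hz hnz => hz (by simpa using h.neg_mem hS hnz)
  have hpos : ∀ a b, 0 < (e a).1 0 → 0 < (e b).1 0 → b ∈ connectedComponentIn Sᶜ a := by
    intro a b ha hb
    refine ((e.isPreconnected_preimage.2
      (isPreconnected_hemisphere n)).subset_connectedComponentIn (x := a) ha ?_) hb
    intro z hz hzS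
    exact (show 0 < (e z).1 0 from hz).ne' ((hmemS z).1 hzS)
  have hneg : ∀ a b, (e a).1 0 < 0 → (e b).1 0 < 0 → b ∈ connectedComponentIn Sᶜ a := by
    intro a b ha hb
    refine ((e.isPreconnected_preimage.2
      (isPreconnected_hemisphere_neg n)).subset_connectedComponentIn (x := a) ha ?_) hb
    intro z hz hzS
    exact (show (e z).1 0 < 0 from hz).ne ((hmemS z).1 hzS)
  have htri : ∀ a ∈ Sᶜ, ∀ b ∈ Sᶜ, ∀ c ∈ Sᶜ, c ∈ connectedComponentIn Sᶜ a ∨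
      c ∈ connectedComponentIn Sᶜ b ∨ b ∈ connectedComponentIn Sᶜ a := by
    intro a ha b hb c hc
    rw [mem_compl_iff, hmemS, ← ne_eq, ne_iff_lt_or_gt] at ha hb hc
    rcases ha with ha | ha <;> rcases hb with hb | hb <;> rcases hc with hc | hc <;>
      first
        | exact Or.inl (hneg _ _ ha hc)
        | exact Or.inl (hpos _ _ ha hc)
        | exact Or.inr (Or.inl (hneg _ _ hb hc))
        | exact Or.inr (Or.inl (hpos _ _ hb hc))
        | exact Or.inr (Or.inr (hneg _ _ ha hb))
        | exact Or.inr (Or.inr (hpos _ _ ha hb))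
  have himg : ∀ a ∈ Sᶜ, ∀ z ∈ connectedComponentIn Sᶜ a, -z ∈ connectedComponentIn Sᶜ (-a) := by
    intro a ha z hz
    have hsub : (fun w : Sph n => -w) '' connectedComponentIn Sᶜ a ⊆
        connectedComponentIn Sᶜ (-a) := by
      refine (isPreconnected_connectedComponentIn.image _
        continuous_neg.continuousOn).subset_connectedComponentIn
        ⟨a, mem_connectedComponentIn ha, rfl⟩ ?_
      rintro _ ⟨w, hw, rfl⟩
      exact hnegS w (connectedComponentIn_subset _ _ hw)
    exact hsub ⟨z, hz, rfl⟩
  rcases htri x hx (-x) (hnegS x hx) y hy with h1 | h1 | h1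
  · exact Or.inl h1
  · right
    simpa using himg (-x) (hnegS x hx) y h1
  · refine absurd (fun z hz => ?_) hsymm
    rw [connectedComponentIn_eq h1]
    exact himg x hx z hz

/-- A continuous involution of the real line has a fixed point. -/
theorem exists_fixed_point_of_involutive {g : ℝ → ℝ} (hg : Continuous g)
    (hinv : Function.Involutive g) : ∃ t, g t = t := by
  rcases le_total (g 0) 0 with h0 | h0
  · obtain ⟨t, -, ht⟩ := isPreconnected_univ.intermediate_value₂ (mem_univ (0 : ℝ))
      (mem_univ (g 0)) hg.continuousOn continuousOn_id h0 (by simpa [hinv 0] using h0)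
    exact ⟨t, ht⟩
  · obtain ⟨t, -, ht⟩ := isPreconnected_univ.intermediate_value₂ (mem_univ (0 : ℝ))
      (mem_univ (g 0)) continuousOn_id hg.continuousOn h0 (by simpa [hinv 0] using h0)
    exact ⟨t, ht.symm⟩

/-- Parallelism is transitive in projectivizable families: two members containing a common point
cannot both be parallel to a vertical line, unless one contains the other. -/
theorem not_projectivizable_of_parallel {𝓐 : Set (Set (Fin 2 → ℝ))} {A B : Set (Fin 2 → ℝ)}
    {c : ℝ} (hV : {x : Fin 2 → ℝ | x 0 = c} ∈ 𝓐) (hA : A ∈ 𝓐) (hB : B ∈ 𝓐)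
    (hVA : Disjoint {x : Fin 2 → ℝ | x 0 = c} A) (hVB : Disjoint {x : Fin 2 → ℝ | x 0 = c} B)
    (hAB : ¬A ⊆ B) (hne : (A ∩ B).Nonempty) : ¬Projectivizable 𝓐 := by
  rintro ⟨𝓢, h𝓢, S₀, hS₀, D, ⟨x₀, hx₀, hD⟩, f, hf⟩
  have key : ∀ L ∈ 𝓐, ∃ S ∈ 𝓢, ∀ x, (f x : Sph 2) ∈ S ↔ x ∈ L := by
    intro L hL
    obtain ⟨S, hS, -, hSD⟩ := hf.subset ⟨L, hL, rfl⟩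
    refine ⟨S, hS, fun x => ?_⟩
    have : (f x : Sph 2) ∈ S ↔ (f x : Sph 2) ∈ S ∩ D := by simp
    rw [this, ← hSD, Subtype.val_injective.mem_set_image, f.injective.mem_set_image]
  have hDS₀ : D ⊆ S₀ᶜ := hD ▸ connectedComponentIn_subset _ _
  have hfS₀ : ∀ x, (f x : Sph 2) ∉ S₀ := fun x => hDS₀ (f x).2
  obtain ⟨SV, hSV, hSV'⟩ := key _ hV
  obtain ⟨SA, hSA, hSA'⟩ := key _ hA
  obtain ⟨SB, hSB, hSB'⟩ := key _ hB
  have hvV : ∀ t : ℝ, ![c, t] ∈ {x : Fin 2 → ℝ | x 0 = c} := fun t => by simp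
  have hsymm : ¬∀ z ∈ D, -z ∈ D := by
    intro hneg
    let r : (Fin 2 → ℝ) → (Fin 2 → ℝ) := fun x => f.symm ⟨-(f x : Sph 2), hneg _ (f x).2⟩
    have hfr : ∀ x, (f (r x) : Sph 2) = -(f x : Sph 2) := fun x => by simp [r]
    have hrc : Continuous r := by fun_prop
    have hrr : ∀ x, r (r x) = x := fun x => by
      apply f.injective
      apply Subtype.ext
      rw [hfr, hfr, neg_neg]
    have hrV : ∀ x : Fin 2 → ℝ, x 0 = c → r x 0 = c := fun x hx => by
      refine (hSV' _).1 ?_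
      rw [hfr]
      exact h𝓢.neg_mem hSV ((hSV' x).2 hx)
    have heta : ∀ x : Fin 2 → ℝ, x 0 = c → ![c, x 1] = x := fun x hx => by
      ext i
      fin_cases i <;> simp [hx]
    obtain ⟨t, ht⟩ := exists_fixed_point_of_involutive (g := fun t => r ![c, t] 1) (by fun_prop)
      (fun t => by simp [heta _ (hrV ![c, t] (hvV t)), hrr])
    have hfix : r ![c, t] = ![c, t] := by
      rw [← heta _ (hrV ![c, t] (hvV t))]
      simp only [ht]
    exact sph_neg_ne_self (f ![c, t] : Sph 2) (by rw [← hfr, hfix])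
  have hcover : ∀ y ∈ S₀ᶜ, y ∈ D ∨ -y ∈ D := by
    subst hD
    exact fun y hy => h𝓢.mem_or_neg_mem_connectedComponentIn hS₀ hx₀ hsymm hy
  have hpar : ∀ L S, S ∈ 𝓢 → (∀ x, (f x : Sph 2) ∈ S ↔ x ∈ L) →
      Disjoint {x : Fin 2 → ℝ | x 0 = c} L → SV ∩ S ⊆ S₀ ∧ ¬SV ⊆ S := by
    intro L S hS hSL hdisj
    have hout : ∀ y ∈ SV ∩ S, y ∉ D := by
      intro y hy hyD
      obtain ⟨x, hx⟩ := f.surjective ⟨y, hyD⟩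
      have hxy : (f x : Sph 2) = y := congrArg Subtype.val hx
      rw [← hxy] at hy
      exact disjoint_left.1 hdisj ((hSV' x).1 hy.1) ((hSL x).1 hy.2)
    constructor
    · intro y hy
      by_contra hyS₀
      rcases hcover y hyS₀ with h | h
      · exact hout y hy h
      · exact hout (-y) ⟨h𝓢.neg_mem hSV hy.1, h𝓢.neg_mem hS hy.2⟩ h
    · intro hsub
      exact disjoint_left.1 hdisj (hvV 0) ((hSL _).1 (hsub ((hSV' _).2 (hvV 0))))
  obtain ⟨hA₀, hVA'⟩ := hpar A SA hSA hSA' hVA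
  obtain ⟨hB₀, hVB'⟩ := hpar B SB hSB hSB' hVB
  obtain ⟨p, hp⟩ := h𝓢.exists_inter_eq_antipodal_pair hSV hSA hVA'
  obtain ⟨q, hq⟩ := h𝓢.exists_inter_eq_antipodal_pair hSV hSB hVB'
  obtain ⟨r, hr⟩ := h𝓢.exists_inter_eq_antipodal_pair hSV hS₀
    (fun hsub => hfS₀ ![c, 0] (hsub ((hSV' _).2 (hvV 0))))
  obtain ⟨w, hwA, hwB⟩ := hne
  obtain ⟨s, hs⟩ := h𝓢.exists_inter_eq_antipodal_pair hSA hSB (fun hsub => hAB fun x hx =>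
    (hSB' x).1 (hsub ((hSA' x).2 hx)))
  have hp' : p ∈ SV ∩ SA := hp ▸ mem_insert _ _
  have hq' : q ∈ SV ∩ SB := hq ▸ mem_insert _ _
  have antipodal : ∀ {X : Set (Sph 2)} {a b m : Sph 2}, X = {m, -m} → a ∈ X → b ∈ X →
      b = a ∨ b = -a := by
    rintro _ a b m rfl (rfl | rfl) (rfl | rfl) <;> simp
  have hpB : p ∈ SB := by
    rcases antipodal hr ⟨hq'.1, hB₀ hq'⟩ ⟨hp'.1, hA₀ hp'⟩ with h | h
    · exact h ▸ hq'.2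
    · exact h ▸ h𝓢.neg_mem hSB hq'.2
  apply hfS₀ w
  rcases antipodal hs ⟨hp'.2, hpB⟩ ⟨(hSA' w).2 hwA, (hSB' w).2 hwB⟩ with h | h
  · exact h ▸ hA₀ hp'
  · exact h ▸ h𝓢.neg_mem hS₀ (hA₀ hp')

/-- in `ℝ²`, the topolines `L₁ = {x₁ = -1}`, `L₂ = {x₁ = 1}`,
`L₃ = {x₂ = 1}` and the bent line `L₄ = {x₁x₂ = 0, x₁ ≥ 0, x₂ ≥ 0}` form an affine
arrangement of topolines that is not projectivizable; indeed `L₁ ∩ L₂ = ∅` and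
`L₁ ∩ L₄ = ∅` but `L₂ ∩ L₄ ≠ ∅`, so parallelism is not transitive. -/
theorem statement14 (L₁ L₂ L₃ L₄ : Set (Fin 2 → ℝ))
    (hL₁ : L₁ = {x | x 0 = -1}) (hL₂ : L₂ = {x | x 0 = 1}) (hL₃ : L₃ = {x | x 1 = 1})
    (hL₄ : L₄ = {x | x 0 * x 1 = 0 ∧ 0 ≤ x 0 ∧ 0 ≤ x 1}) :
    IsArrangement {L₁, L₂, L₃, L₄} ∧ PairwiseAffine {L₁, L₂, L₃, L₄} ∧
      ¬Projectivizable {L₁, L₂, L₃, L₄} ∧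
      L₁ ∩ L₂ = ∅ ∧ L₁ ∩ L₄ = ∅ ∧ (L₂ ∩ L₄).Nonempty := by
  subst hL₁ hL₂ hL₃ hL₄
  set L₁ : Set (Fin 2 → ℝ) := {x | x 0 = -1} with hL₁
  set L₂ : Set (Fin 2 → ℝ) := {x | x 0 = 1} with hL₂
  set L₃ : Set (Fin 2 → ℝ) := {x | x 1 = 1} with hL₃
  set L₄ : Set (Fin 2 → ℝ) := {x | x 0 * x 1 = 0 ∧ 0 ≤ x 0 ∧ 0 ≤ x 1} with hL₄
  have h12 : L₁ ∩ L₂ = ∅ := by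
    ext x
    simp only [hL₁, hL₂, mem_inter_iff, mem_ofPred_eq, mem_empty_iff_false, iff_false]
    rintro ⟨h, h'⟩
    linarith
  have h14 : L₁ ∩ L₄ = ∅ := by
    ext x
    simp only [hL₁, hL₄, mem_inter_iff, mem_ofPred_eq, mem_empty_iff_false, iff_false]
    rintro ⟨h, -, h', -⟩
    linarith
  have h24 : (L₂ ∩ L₄).Nonempty := ⟨![1, 0], by simp [hL₂], by simp [hL₄]⟩
  have c13 : Crosses L₁ L₃ := crosses_vertical_horizontal (-1) 1
  have c23 : Crosses L₂ L₃ := crosses_vertical_horizontal 1 1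
  have c42 : Crosses L₄ L₂ := crosses_quadrantBoundary_vertical
  have c43 : Crosses L₄ L₃ := crosses_quadrantBoundary_horizontal
  have haff : PairwiseAffine {L₁, L₂, L₃, L₄} := by
    rintro A (rfl | rfl | rfl | rfl) B (rfl | rfl | rfl | rfl) hne
    · exact absurd rfl hne
    · exact Or.inl h12
    · exact Or.inr c13
    · exact Or.inl h14
    · exact Or.inl (by rwa [inter_comm])
    · exact absurd rfl hne
    · exact Or.inr c23
    · exact Or.inr c42.symm
    · exact Or.inr c13.symm
    · exact Or.inr c23.symm
    · exact absurd rfl hne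
    · exact Or.inr c43.symm
    · exact Or.inl (by rwa [inter_comm])
    · exact Or.inr c42
    · exact Or.inr c43
    · exact absurd rfl hne
  refine ⟨haff.isArrangement (by simp) ?_, haff, ?_, h12, h14, h24⟩
  · rintro A (rfl | rfl | rfl | rfl)
    exacts [c13.isTopoplane, c23.isTopoplane, c13.symm.isTopoplane, c42.isTopoplane]
  · refine not_projectivizable_of_parallel (c := -1) (A := L₂) (B := L₄) (by simp [hL₁])
      (by simp) (by simp) (disjoint_iff_inter_eq_empty.2 h12)
      (disjoint_iff_inter_eq_empty.2 h14) (fun hsub => ?_) h24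
    have := @hsub ![1, 1] (by simp [hL₂])
    simp [hL₄] at this
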